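/- arXiv:1904.01621 — 2 statements merged into one kernel-verified Lean document; each statement's English description precedes it below -/
import Mathlib

section
/- If τ ≠ Id is the nontrivial diagram involution of the Dynkin diagram of type A_{2r+1}, then the restricted Weyl group W_τ = { w ∈ W(A_{2r+1}) : τw = wτ } is isomorphic to the Weyl group of type B_{r+1}, generated by the elements bs_0 = s_0 and bs_i = s_i s_{−i} for 1 ≤ i ≤ r (with vertices labeled −r,…,−1,0,1,…,r and τ(i) = −i). -/
section Involutions

variable {G : Type*} [Group G] {x y : G}

theorem mul_pow_two_eq_one_iff_of_involutive (hx : x * x = 1) (hy : y * y = 1) :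
    (x * y) ^ 2 = 1 ↔ x * y = y * x := by
  rw [pow_two, mul_eq_one_iff_eq_inv, mul_inv_rev, inv_eq_of_mul_eq_one_left hx,
    inv_eq_of_mul_eq_one_left hy]

theorem mul_pow_three_eq_one_iff_of_involutive (hx : x * x = 1) (hy : y * y = 1) :
    (x * y) ^ 3 = 1 ↔ x * y * x = y * x * y := by
  have h : (x * y) ^ 3 = (x * y * x) * (y * x * y) := by simp only [pow_succ, pow_zero]; group
  rw [h, mul_eq_one_iff_eq_inv, mul_inv_rev, mul_inv_rev, inv_eq_of_mul_eq_one_left hx,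
    inv_eq_of_mul_eq_one_left hy, mul_assoc y]

theorem mul_pow_four_eq_one_iff_of_involutive (hx : x * x = 1) (hy : y * y = 1) :
    (x * y) ^ 4 = 1 ↔ x * y * x * y = y * x * y * x := by
  have h : (x * y) ^ 4 = (x * y * x * y) * (x * y * x * y) := by
    simp only [pow_succ, pow_zero]; group
  rw [h, mul_eq_one_iff_eq_inv]
  simp only [mul_inv_rev, inv_eq_of_mul_eq_one_left hx, inv_eq_of_mul_eq_one_left hy, mul_assoc]

end Involutions

section PermutationRepresentation

variable {G : Type*} [Group G] (π : G →* Equiv.Perm ℤ)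

/-- A form of Schreier's lemma: `d` is a transversal for the orbit `I` of `x`. -/
theorem mem_of_mem_closure_of_apply_eq {S : Set G} {P : Subgroup G} {d : ℤ → G} {I : Set ℤ} {x : ℤ}
    (hx : x ∈ I) (hd : d x = 1)
    (hS : ∀ s ∈ S, ∀ y ∈ I, π s y ∈ I ∧ (d (π s y))⁻¹ * s * d y ∈ P)
    (hinv : ∀ s ∈ S, s * s = 1) {w : G} (hw : w ∈ Subgroup.closure S) (hwx : π w x = x) :
    w ∈ P := by
  have key : ∀ y ∈ I, π w y ∈ I ∧ (d (π w y))⁻¹ * w * d y ∈ P := by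
    have step : ∀ s ∈ S, ∀ u : G, (∀ y ∈ I, π u y ∈ I ∧ (d (π u y))⁻¹ * u * d y ∈ P) →
        ∀ y ∈ I, π (s * u) y ∈ I ∧ (d (π (s * u) y))⁻¹ * (s * u) * d y ∈ P := by
      intro s hs u hu y hy
      obtain ⟨h1, h2⟩ := hu y hy
      obtain ⟨h3, h4⟩ := hS s hs _ h1
      rw [map_mul, Equiv.Perm.mul_apply]
      exact ⟨h3, by simpa [mul_assoc] using P.mul_mem h4 h2⟩
    clear hwx
    induction hw using Subgroup.closure_induction_left with
    | one => simp +contextual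
    | mul_left s hs u _ ih =>
      exact step s hs u ih
    | inv_mul_cancel s hs u _ ih =>
      rw [inv_eq_of_mul_eq_one_left (hinv s hs)]
      exact step s hs u ih
  have := (key x hx).2
  rwa [hwx, hd, inv_one, one_mul, mul_one] at this

theorem exists_descending_products (g : ℤ → G) (m : ℤ) :
    ∃ d : ℤ → G, d m = 1 ∧ ∀ y < m, d y = g y * d (y + 1) := by
  let D : ℕ → G := fun k => Nat.rec 1 (fun k u => g (m - k - 1) * u) k
  refine ⟨fun y => D (m - y).toNat, by simp [D], fun y hy => ?_⟩
  obtain ⟨k, rfl⟩ : ∃ k : ℕ, y = m - k - 1 := ⟨(m - y - 1).toNat, by omega⟩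
  have h1 : (m - (m - k - 1)).toNat = k + 1 := by omega
  have h2 : (m - (m - k - 1 + 1)).toNat = k := by omega
  simp only [h1, h2, D]

/-- The standard permutation representation of a group satisfying the relations of type `A` is
faithful. -/
theorem eq_one_of_typeA_relations {b : ℤ → G} {lo hi : ℤ}
    (hsq : ∀ i, lo ≤ i → i < hi → b i * b i = 1)
    (hcomm : ∀ i j, lo ≤ i → i + 1 < j → j < hi → b i * b j = b j * b i)
    (hbraid : ∀ i, lo ≤ i → i + 1 < hi → b i * b (i + 1) * b i = b (i + 1) * b i * b (i + 1))
    (hπ : ∀ i, lo ≤ i → i < hi → π (b i) = Equiv.swap i (i + 1))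
    (m : ℤ) (hlo : lo ≤ m) (hm : m ≤ hi) (w : G) (hw : w ∈ Subgroup.closure (b '' Set.Ico lo m))
    (hw1 : π w = 1) : w = 1 := by
  induction m, hlo using Int.leInduction generalizing w with
  | base => simpa using hw
  | succ m hlo ih =>
    refine ih (by omega) w ?_ hw1
    obtain ⟨d, hd0, hd⟩ := exists_descending_products b (m + 1)
    have fixed : ∀ k : ℕ, ∀ y, y = m + 1 - k → lo ≤ y → ∀ i, lo ≤ i → i < m + 1 → i ≠ y →
        i + 1 ≠ y → (d y)⁻¹ * b i * d y ∈ Subgroup.closure (b '' Set.Ico lo m) := by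
      intro k
      induction k using Nat.strong_induction_on with
      | _ k ihk =>
        intro y hy hly i hli him h1 h2
        rcases Nat.eq_zero_or_pos k with rfl | hk
        · obtain rfl : y = m + 1 := by omega
          rw [hd0, inv_one, one_mul, mul_one]
          exact Subgroup.subset_closure ⟨i, ⟨hli, by omega⟩, rfl⟩
        rw [hd y (by omega)]
        by_cases h3 : i = y + 1
        · subst h3
          have := ihk (k - 2) (by omega) (y + 1 + 1) (by omega) (by omega) y hly (by omega)
            (by omega) (by omega)
          rw [hd (y + 1) (by omega)]
          convert this using 1
          have hb := hbraid y hly (by omega)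
          have : b (y + 1) * (b y * (b (y + 1) * d (y + 1 + 1)))
              = b y * (b (y + 1) * (b y * d (y + 1 + 1))) := by
            simp only [← mul_assoc]; rw [hb]
          simp [mul_assoc, this]
        · have := ihk (k - 1) (by omega) (y + 1) (by omega) (by omega) i hli him (by omega)
            (by omega)
          convert this using 1
          have hb : b i * b y = b y * b i := by
            rcases lt_or_gt_of_ne h1 with h | h
            · exact hcomm i y hli (by omega) (by omega)
            · exact (hcomm y i hly (by omega) (by omega)).symm
          rw [mul_inv_rev, mul_assoc, ← mul_assoc (b i), hb]
          group
    refine mem_of_mem_closure_of_apply_eq π (I := Set.Icc lo (m + 1)) (x := m + 1)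
      ⟨by omega, le_rfl⟩ hd0 ?_ ?_ hw (by simp [hw1])
    · rintro _ ⟨i, ⟨hi1, hi2⟩, rfl⟩ y ⟨hy1, hy2⟩
      rw [hπ i hi1 (by omega), Equiv.swap_apply_def]
      split_ifs with h1 h2
      · subst h1
        refine ⟨⟨by omega, by omega⟩, ?_⟩
        rw [hd y (by omega), mul_assoc, ← mul_assoc (b y), hsq y hy1 (by omega)]
        simp
      · subst h2
        refine ⟨⟨by omega, by omega⟩, ?_⟩
        rw [hd i (by omega)]
        simp [mul_assoc]
      · exact ⟨⟨hy1, hy2⟩, fixed (m + 1 - y).toNat y (by omega) hy1 i hi1 hi2 (by omega)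
          (by omega)⟩
    · rintro _ ⟨i, ⟨hi1, hi2⟩, rfl⟩
      exact hsq i hi1 (by omega)

/-- The permutation representation of a group satisfying the relations of type `B`, by
permutations of `ℤ` commuting with `x ↦ 1 - x`, is faithful. -/
theorem eq_one_of_typeB_relations {b : ℕ → G} {n : ℕ}
    (hsq : ∀ i < n, b i * b i = 1)
    (hcomm : ∀ i j, i + 1 < j → j < n → b i * b j = b j * b i)
    (hbraid : ∀ i, 1 ≤ i → i + 1 < n → b i * b (i + 1) * b i = b (i + 1) * b i * b (i + 1))
    (hbraid' : 1 < n → b 0 * b 1 * b 0 * b 1 = b 1 * b 0 * b 1 * b 0)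
    (hπ : ∀ i < n, ∀ y : ℤ, π (b i) y = if y = i then (i : ℤ) + 1 else if y = i + 1 then (i : ℤ)
      else if y = -i then -(i : ℤ) + 1 else if y = -i + 1 then -(i : ℤ) else y)
    (m : ℕ) (hm : m ≤ n) (w : G) (hw : w ∈ Subgroup.closure (b '' Set.Iio m))
    (hw1 : π w = 1) : w = 1 := by
  induction m generalizing w with
  | zero => simpa using hw
  | succ m ih =>
    refine ih (by omega) w ?_ hw1
    obtain ⟨d, hd0, hd⟩ := exists_descending_products (fun y => b y.natAbs) (m + 1)
    have fixed : ∀ k : ℕ, ∀ y : ℤ, y = m + 1 - k → -(m : ℤ) ≤ y → ∀ i < m + 1,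
        y ≠ i → y ≠ i + 1 → y ≠ -i → y ≠ -i + 1 →
        (d y)⁻¹ * b i * d y ∈ Subgroup.closure (b '' Set.Iio m) := by
      intro k
      induction k using Nat.strong_induction_on with
      | _ k ihk =>
        intro y hy hly i him h1 h2 h3 h4
        rcases Nat.eq_zero_or_pos k with rfl | hk
        · obtain rfl : y = m + 1 := by omega
          rw [hd0, inv_one, one_mul, mul_one]
          exact Subgroup.subset_closure ⟨i, by simp; omega, rfl⟩
        have hcomm' : ∀ i j, i < n → j < n → (i + 1 < j ∨ j + 1 < i) → b i * b j = b j * b i := by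
          rintro i j hi hj (h | h)
          · exact hcomm i j h hj
          · exact (hcomm j i h hi).symm
        have hfar : i + 1 < y.natAbs ∨ y.natAbs + 1 < i ∨ (i = 0 ∧ y = -1) ∨
            (1 ≤ y ∧ (i : ℤ) = y + 1) ∨ (1 ≤ i ∧ y = -i - 1) := by omega
        rw [← or_assoc] at hfar
        rcases hfar with h | ⟨rfl, rfl⟩ | ⟨hy1, hiy⟩ | ⟨hi1, rfl⟩
        · have := ihk (k - 1) (by omega) (y + 1) (by omega) (by omega) i him (by omega)
            (by omega) (by omega) (by omega)
          convert this using 1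
          rw [hd y (by omega), mul_inv_rev, mul_assoc, ← mul_assoc (b i),
            hcomm' _ _ (by omega) (by omega) h]
          group
        · have := ihk (k - 3) (by omega) 2 (by omega) (by omega) 0 him (by simp)
            (by simp) (by simp) (by simp)
          convert this using 1
          have e : d (-1) = b 1 * (b 0 * (b 1 * d 2)) := by
            rw [hd (-1) (by omega), show (-1 : ℤ) + 1 = 0 by norm_num, hd 0 (by omega),
              show (0 : ℤ) + 1 = 1 by norm_num, hd 1 (by omega)]
            rfl
          have hb : b 0 * d (-1) = b 1 * (b 0 * (b 1 * (b 0 * d 2))) := by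
            rw [e]; simp only [← mul_assoc]; rw [hbraid' (by omega)]
          rw [mul_assoc, hb, e]
          group
        · have := ihk (k - 2) (by omega) (y + 1 + 1) (by omega) (by omega) y.natAbs (by omega)
            (by omega) (by omega) (by omega) (by omega)
          convert this using 1
          have e : d y = b y.natAbs * (b i * d (y + 1 + 1)) := by
            rw [hd y (by omega), hd (y + 1) (by omega), show i = (y + 1).natAbs by omega]
          have hb : b i * d y = b y.natAbs * (b i * (b y.natAbs * d (y + 1 + 1))) := by
            rw [e]; simp only [← mul_assoc]
            rw [show i = y.natAbs + 1 by omega, hbraid y.natAbs (by omega) (by omega)]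
          rw [mul_assoc, hb, e]
          group
        · have := ihk (k - 2) (by omega) (-i + 1) (by omega) (by omega) (i + 1) (by omega)
            (by omega) (by omega) (by omega) (by omega)
          convert this using 1
          have e : d (-i - 1) = b (i + 1) * (b i * d (-i + 1)) := by
            rw [hd (-i - 1) (by omega), show (-i - 1 : ℤ) + 1 = -i by ring, hd (-i) (by omega),
              show (-i - 1 : ℤ).natAbs = i + 1 by omega, show (-i : ℤ).natAbs = i by omega]
          have hb : b i * d (-i - 1) = b (i + 1) * (b i * (b (i + 1) * d (-i + 1))) := by
            rw [e]; simp only [← mul_assoc]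
            rw [hbraid i hi1 (by omega)]
          rw [mul_assoc, hb, e]
          group
    have down : ∀ y : ℤ, -(m : ℤ) ≤ y → y < m + 1 →
        (d (y + 1))⁻¹ * b y.natAbs * d y ∈ Subgroup.closure (b '' Set.Iio m) := by
      intro y hy1 hy2
      rw [hd y hy2, mul_assoc, ← mul_assoc (b y.natAbs), hsq _ (by omega)]
      simp
    have up : ∀ y : ℤ, -(m : ℤ) ≤ y → y < m + 1 →
        (d y)⁻¹ * b y.natAbs * d (y + 1) ∈ Subgroup.closure (b '' Set.Iio m) := by
      intro y hy1 hy2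
      rw [hd y hy2]
      simp [mul_assoc]
    refine mem_of_mem_closure_of_apply_eq π (I := Set.Icc (-m : ℤ) (m + 1)) (x := m + 1)
      ⟨by omega, le_rfl⟩ hd0 ?_ ?_ hw (by simp [hw1])
    · rintro _ ⟨i, hi, rfl⟩ y ⟨hy1, hy2⟩
      rw [Set.mem_Iio] at hi
      rw [hπ i (by omega)]
      split_ifs with h1 h2 h3 h4
      · subst h1
        exact ⟨⟨by omega, by omega⟩, down i (by omega) (by omega)⟩
      · subst h2
        exact ⟨⟨by omega, by omega⟩, up i (by omega) (by omega)⟩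
      · subst h3
        refine ⟨⟨by omega, by omega⟩, ?_⟩
        simpa using down (-i) (by omega) (by omega)
      · subst h4
        refine ⟨⟨by omega, by omega⟩, ?_⟩
        simpa using up (-i) (by omega) (by omega)
      · exact ⟨⟨hy1, hy2⟩, fixed (m + 1 - y).toNat y (by omega) hy1 i hi h1 h2 h3 h4⟩
    · rintro _ ⟨i, hi, rfl⟩
      rw [Set.mem_Iio] at hi
      exact hsq i (by omega)

/-- Transitivity: the type `B` generators generate every element which acts on `[1 - m, m]`
compatibly with `x ↦ 1 - x`. -/
theorem mem_closure_of_commutes_with_reversal {b : ℕ → G} {n : ℕ}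
    (hπ : ∀ i < n, ∀ y : ℤ, π (b i) y = if y = i then (i : ℤ) + 1 else if y = i + 1 then (i : ℤ)
      else if y = -i then -(i : ℤ) + 1 else if y = -i + 1 then -(i : ℤ) else y)
    (hinj : Function.Injective π) (m : ℕ) (hm : m ≤ n) (w : G)
    (hrev : ∀ y, π w (1 - y) = 1 - π w y)
    (hfix : ∀ y, (m : ℤ) < y → π w y = y) :
    w ∈ Subgroup.closure (b '' Set.Iio m) := by
  induction m generalizing w with
  | zero =>
    have : w = 1 := hinj <| Equiv.ext fun y => by
      rw [map_one, Equiv.Perm.one_apply]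
      by_cases hy : 0 < y
      · exact hfix y (by simpa using hy)
      · have := hrev (1 - y)
        rw [hfix (1 - y) (by push_cast; omega)] at this
        simpa using this
    rw [this]; exact one_mem _
  | succ m ih =>
    have hrev' : ∀ i < n, ∀ y, π (b i) (1 - y) = 1 - π (b i) y := by
      intro i hi y
      rw [hπ i hi, hπ i hi]
      split_ifs <;> omega
    have trans : ∀ k : ℕ, ∀ y : ℤ, y = m + 1 - k → -(m : ℤ) ≤ y →
        ∃ u ∈ Subgroup.closure (b '' Set.Iio (m + 1)), π u (m + 1) = y ∧
          (∀ z, π u (1 - z) = 1 - π u z) ∧ ∀ z, (m : ℤ) + 1 < z → π u z = z := by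
      intro k
      induction k with
      | zero => exact fun y hy _ => ⟨1, one_mem _, by simp [hy], by simp, by simp⟩
      | succ k ihk =>
        intro y hy hly
        obtain ⟨u, hu, hu1, hu2, hu3⟩ := ihk (y + 1) (by omega) (by omega)
        refine ⟨b y.natAbs * u, mul_mem (Subgroup.subset_closure ⟨_, by simp; omega, rfl⟩) hu,
          ?_, ?_, ?_⟩
        · rw [map_mul, Equiv.Perm.mul_apply, hu1, hπ _ (by omega)]
          split_ifs <;> omega
        · intro z
          rw [map_mul, Equiv.Perm.mul_apply, Equiv.Perm.mul_apply, hu2, hrev' _ (by omega)]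
        · intro z hz
          rw [map_mul, Equiv.Perm.mul_apply, hu3 z hz, hπ _ (by omega)]
          split_ifs <;> omega
    have hle : π w (m + 1) ≤ m + 1 := by
      by_contra! h
      have := (π w).injective (hfix _ (by push_cast; exact h))
      omega
    have hge : -(m : ℤ) ≤ π w (m + 1) := by
      by_contra! h
      have h1 := hfix (1 - π w (m + 1)) (by push_cast; omega)
      rw [hrev] at h1
      have h2 := (π w).injective (sub_right_injective h1)
      omega
    obtain ⟨u, hu, hu1, hu2, hu3⟩ := trans (m + 1 - π w (m + 1)).toNat _ (by omega) hge
    have hmem : u⁻¹ * w ∈ Subgroup.closure (b '' Set.Iio m) := by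
      refine ih (by omega) _ ?_ ?_
      · intro y
        rw [map_mul, map_inv, Equiv.Perm.mul_apply, Equiv.Perm.mul_apply, hrev,
          Equiv.Perm.inv_eq_iff_eq, hu2]
        simp
      · intro y hy
        rw [map_mul, map_inv, Equiv.Perm.mul_apply, Equiv.Perm.inv_eq_iff_eq]
        rcases eq_or_ne y (m + 1) with rfl | hne
        · exact hu1.symm
        · rw [hu3 y (by omega), hfix y (by push_cast; omega)]
    have := mul_mem hu (Subgroup.closure_mono
      (Set.image_mono (Set.Iio_subset_Iio (Nat.le_succ m))) hmem)
    rwa [mul_inv_cancel_left] at this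

end PermutationRepresentation

section CoxeterGroups

theorem typeB_relations_of_typeA_relations {G : Type*} [Group G] {s : ℤ → G} {r : ℕ} {b : ℕ → G}
    (hb0 : b 0 = s 0) (hb : ∀ i, 1 ≤ i → b i = s i * s (-i))
    (hsq : ∀ i, -(r : ℤ) ≤ i → i < r + 1 → s i * s i = 1)
    (hcomm : ∀ i j, -(r : ℤ) ≤ i → i + 1 < j → j < (r : ℤ) + 1 → s i * s j = s j * s i)
    (hbraid : ∀ i, -(r : ℤ) ≤ i → i + 1 < (r : ℤ) + 1 →
      s i * s (i + 1) * s i = s (i + 1) * s i * s (i + 1)) :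
    (∀ i < r + 1, b i * b i = 1) ∧
    (∀ i j, i + 1 < j → j < r + 1 → b i * b j = b j * b i) ∧
    (∀ i, 1 ≤ i → i + 1 < r + 1 → b i * b (i + 1) * b i = b (i + 1) * b i * b (i + 1)) ∧
    (1 < r + 1 → b 0 * b 1 * b 0 * b 1 = b 1 * b 0 * b 1 * b 0) := by
  have hc : ∀ i j : ℤ, -(r : ℤ) ≤ i → i < r + 1 → -(r : ℤ) ≤ j → j < r + 1 →
      (i + 1 < j ∨ j + 1 < i) → Commute (s i) (s j) := by
    rintro i j h1 h2 h3 h4 (h | h)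
    · exact hcomm i j h1 h h4
    · exact (hcomm j i h3 h h2).symm
  refine ⟨fun i hi => ?_, fun i j hij hj => ?_, fun i hi hir => ?_, fun hr => ?_⟩
  · rcases Nat.eq_zero_or_pos i with rfl | hi0
    · rw [hb0]; exact hsq 0 (by omega) (by omega)
    · rw [hb i hi0, (hc (-i) i (by omega) (by omega) (by omega) (by omega)
        (by omega)).mul_mul_mul_comm, hsq _ (by omega) (by omega), hsq _ (by omega) (by omega),
        one_mul]
  · rw [hb j (by omega)]
    rcases Nat.eq_zero_or_pos i with rfl | hi0
    · rw [hb0]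
      exact ((hc _ _ (by omega) (by omega) (by omega) (by omega) (by omega)).mul_right
        (hc _ _ (by omega) (by omega) (by omega) (by omega) (by omega))).eq
    · rw [hb i hi0]
      exact (((hc _ _ (by omega) (by omega) (by omega) (by omega) (by omega)).mul_right
        (hc _ _ (by omega) (by omega) (by omega) (by omega) (by omega))).mul_left
        ((hc _ _ (by omega) (by omega) (by omega) (by omega) (by omega)).mul_right
        (hc _ _ (by omega) (by omega) (by omega) (by omega) (by omega)))).eq
  · rw [hb i hi, hb (i + 1) (by omega)]
    push_cast
    have h1 := hbraid i (by omega) (by omega)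
    have h2 := hbraid (-(i + 1)) (by omega) (by omega)
    rw [show -((i : ℤ) + 1) + 1 = -i by ring] at h2
    have c1 := hc (-i) (i + 1) (by omega) (by omega) (by omega) (by omega) (by omega)
    have c2 := hc (-i) i (by omega) (by omega) (by omega) (by omega) (by omega)
    have c3 := hc (-(i + 1)) (i + 1) (by omega) (by omega) (by omega) (by omega) (by omega)
    have c4 := hc (-(i + 1)) i (by omega) (by omega) (by omega) (by omega) (by omega)
    rw [c1.mul_mul_mul_comm, (c2.mul_left c4).mul_mul_mul_comm, h1, ← h2, c4.mul_mul_mul_comm,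
      (c3.mul_left c1).mul_mul_mul_comm]
  · rw [hb0, hb 1 le_rfl]
    push_cast
    have h1 := hbraid 0 (by omega) (by omega)
    have h2 := hbraid (-1) (by omega) (by omega)
    norm_num at h1 h2
    have c := (hc 1 (-1) (by omega) (by omega) (by omega) (by omega) (by omega)).eq
    generalize s 0 = x at *
    generalize s 1 = y at *
    generalize s (-1) = z at *
    calc x * (y * z) * x * (y * z) = x * (y * z) * x * (z * y) :=
          congrArg (x * (y * z) * x * ·) c
      _ = x * y * (z * x * z) * y := by simp only [mul_assoc]
      _ = (x * y * x) * z * x * y := by rw [h2]; simp only [mul_assoc]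
      _ = y * x * (y * z) * x * y := by rw [h1]; simp only [mul_assoc]
      _ = y * x * z * (y * x * y) := by rw [c]; simp only [mul_assoc]
      _ = y * (x * z * x) * y * x := by rw [← h1]; simp only [mul_assoc]
      _ = y * z * x * (z * y) * x := by rw [← h2]; simp only [mul_assoc]
      _ = y * z * x * (y * z) * x := by rw [c]

theorem CoxeterMatrix.A_apply {n : ℕ} (i j : Fin n) : CoxeterMatrix.A n i j =
    if i = j then 1 else if (j : ℕ) + 1 = i ∨ (i : ℕ) + 1 = j then 3 else 2 := rfl

theorem CoxeterMatrix.B_apply {n : ℕ} (i j : Fin n) : CoxeterMatrix.B n i j =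
    if i = j then 1 else if (i : ℕ) = n - 1 ∧ (j : ℕ) = n - 2 ∨ (j : ℕ) = n - 1 ∧ (i : ℕ) = n - 2
      then 4 else if (j : ℕ) + 1 = i ∨ (i : ℕ) + 1 = j then 3 else 2 := rfl

theorem swap_succ_braid (a : ℤ) :
    Equiv.swap a (a + 1) * Equiv.swap (a + 1) (a + 1 + 1) * Equiv.swap a (a + 1) =
      Equiv.swap (a + 1) (a + 1 + 1) * Equiv.swap a (a + 1) * Equiv.swap (a + 1) (a + 1 + 1) := by
  rw [Equiv.swap_mul_swap_mul_swap (by omega) (by omega), Equiv.swap_comm a (a + 1),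
    Equiv.swap_comm (a + 1) (a + 1 + 1), Equiv.swap_mul_swap_mul_swap (by omega) (by omega),
    Equiv.swap_comm]

theorem exists_typeA_presentation {r : ℕ} {W : Type*} [Group W]
    (cs : CoxeterSystem (CoxeterMatrix.A (2 * r + 1)) W) :
    ∃ s : ℤ → W, (∀ k : Fin (2 * r + 1), s (k - r) = cs.simple k) ∧
      (∀ i, -(r : ℤ) ≤ i → i < r + 1 → s i * s i = 1) ∧
      (∀ i j, -(r : ℤ) ≤ i → i + 1 < j → j < (r : ℤ) + 1 → s i * s j = s j * s i) ∧
      (∀ i, -(r : ℤ) ≤ i → i + 1 < (r : ℤ) + 1 →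
        s i * s (i + 1) * s i = s (i + 1) * s i * s (i + 1)) ∧
      ∃ ρ : W →* Equiv.Perm ℤ, ∀ i, -(r : ℤ) ≤ i → i < r + 1 → ρ (s i) = Equiv.swap i (i + 1) := by
  let s : ℤ → W := fun i => if h : (i + r).toNat < 2 * r + 1 then cs.simple ⟨_, h⟩ else 1
  have hs : ∀ k : Fin (2 * r + 1), s (k - r) = cs.simple k := by
    intro k
    have : ((k : ℤ) - r + r).toNat = k := by omega
    simp only [s, this, k.isLt, dite_true]
  have hs' : ∀ i : ℤ, -(r : ℤ) ≤ i → i < r + 1 → ∃ k : Fin (2 * r + 1), i = k - r := fun i h1 h2 =>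
    ⟨⟨(i + r).toNat, by omega⟩, by simp; omega⟩
  refine ⟨s, hs, ?_, ?_, ?_, ?_⟩
  · intro i h1 h2
    obtain ⟨k, rfl⟩ := hs' i h1 h2
    simp [hs]
  · intro i j h1 h2 h3
    obtain ⟨k, rfl⟩ := hs' i h1 (by omega)
    obtain ⟨l, rfl⟩ := hs' j (by omega) h3
    rw [hs, hs, ← mul_pow_two_eq_one_iff_of_involutive (by simp) (by simp)]
    have := cs.simple_mul_simple_pow k l
    rwa [CoxeterMatrix.A_apply, if_neg (by rintro rfl; omega), if_neg (by omega)] at this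
  · intro i h1 h2
    obtain ⟨k, rfl⟩ := hs' i h1 (by omega)
    obtain ⟨l, hl⟩ := hs' (k - r + 1) (by omega) h2
    rw [hl, hs, hs, ← mul_pow_three_eq_one_iff_of_involutive (by simp) (by simp)]
    have := cs.simple_mul_simple_pow k l
    rwa [CoxeterMatrix.A_apply, if_neg (by rintro rfl; omega), if_pos (by omega)] at this
  · have hlift : (CoxeterMatrix.A (2 * r + 1)).IsLiftable
        (fun k => Equiv.swap ((k : ℤ) - r) (k - r + 1)) := by
      intro k l
      rw [CoxeterMatrix.A_apply]
      have hk : k = l ∨ (k : ℕ) ≠ l := by omega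
      split_ifs with h1 h2
      · simp [h1]
      · rw [mul_pow_three_eq_one_iff_of_involutive (by simp) (by simp)]
        dsimp only
        rcases h2 with h2 | h2
        · rw [show (k : ℤ) - r = l - r + 1 by omega]
          exact (swap_succ_braid _).symm
        · rw [show (l : ℤ) - r = k - r + 1 by omega]
          exact swap_succ_braid _
      · rw [mul_pow_two_eq_one_iff_of_involutive (by simp) (by simp), Equiv.mul_swap_eq_swap_mul,
          Equiv.swap_apply_of_ne_of_ne (by omega) (by omega),
          Equiv.swap_apply_of_ne_of_ne (by omega) (by omega)]
    refine ⟨cs.lift ⟨_, hlift⟩, fun i h1 h2 => ?_⟩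
    obtain ⟨k, rfl⟩ := hs' i h1 h2
    rw [hs, cs.lift_apply_simple hlift]

theorem exists_typeB_presentation {r : ℕ} {W : Type*} [Group W]
    (cs : CoxeterSystem (CoxeterMatrix.B (r + 1)) W) :
    ∃ b : ℕ → W, Subgroup.closure (b '' Set.Iio (r + 1)) = ⊤ ∧
      (∀ i < r + 1, b i * b i = 1) ∧
      (∀ i j, i + 1 < j → j < r + 1 → b i * b j = b j * b i) ∧
      (∀ i, 1 ≤ i → i + 1 < r + 1 → b i * b (i + 1) * b i = b (i + 1) * b i * b (i + 1)) ∧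
      (1 < r + 1 → b 0 * b 1 * b 0 * b 1 = b 1 * b 0 * b 1 * b 0) ∧
      ∀ (G : Type _) [Group G] (c : ℕ → G),
        (∀ i < r + 1, c i * c i = 1) →
        (∀ i j, i + 1 < j → j < r + 1 → c i * c j = c j * c i) →
        (∀ i, 1 ≤ i → i + 1 < r + 1 → c i * c (i + 1) * c i = c (i + 1) * c i * c (i + 1)) →
        (1 < r + 1 → c 0 * c 1 * c 0 * c 1 = c 1 * c 0 * c 1 * c 0) →
        ∃ φ : W →* G, ∀ i < r + 1, φ (b i) = c i := by
  let b : ℕ → W := fun i => cs.simple ⟨r - i, by omega⟩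
  refine ⟨b, ?_, ?_, ?_, ?_, ?_, ?_⟩
  · rw [← cs.subgroup_closure_range_simple]
    congr 1
    ext w
    constructor
    · rintro ⟨i, -, rfl⟩
      exact ⟨_, rfl⟩
    · rintro ⟨k, rfl⟩
      refine ⟨r - k, Set.mem_Iio.2 (by omega), ?_⟩
      simp only [b]
      congr 1
      ext
      simp
      omega
  · simp [b]
  · intro i j h1 h2
    rw [← mul_pow_two_eq_one_iff_of_involutive (by simp [b]) (by simp [b])]
    have := cs.simple_mul_simple_pow ⟨r - i, by omega⟩ ⟨r - j, by omega⟩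
    rwa [CoxeterMatrix.B_apply, if_neg (by simp; omega), if_neg (by simp; omega),
      if_neg (by simp; omega)] at this
  · intro i h1 h2
    rw [← mul_pow_three_eq_one_iff_of_involutive (by simp [b]) (by simp [b])]
    have := cs.simple_mul_simple_pow ⟨r - i, by omega⟩ ⟨r - (i + 1), by omega⟩
    rwa [CoxeterMatrix.B_apply, if_neg (by simp; omega), if_neg (by simp; omega),
      if_pos (by simp; omega)] at this
  · intro h
    rw [← mul_pow_four_eq_one_iff_of_involutive (by simp [b]) (by simp [b])]
    have := cs.simple_mul_simple_pow ⟨r - 0, by omega⟩ ⟨r - 1, by omega⟩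
    rwa [CoxeterMatrix.B_apply, if_neg (by simp; omega), if_pos (by simp)] at this
  · intro G _ c hsq hcomm hbraid hbraid'
    have hlift : (CoxeterMatrix.B (r + 1)).IsLiftable (fun k => c (r - k)) := by
      intro k l
      rw [CoxeterMatrix.B_apply]
      split_ifs with h1 h2 h3
      · subst h1
        simpa using hsq _ (by omega)
      · rw [mul_pow_four_eq_one_iff_of_involutive (hsq _ (by omega)) (hsq _ (by omega))]
        rcases h2 with ⟨h2, h3⟩ | ⟨h2, h3⟩
        · rw [show r - (k : ℕ) = 0 by omega, show r - (l : ℕ) = 1 by omega]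
          exact hbraid' (by omega)
        · rw [show r - (l : ℕ) = 0 by omega, show r - (k : ℕ) = 1 by omega]
          exact (hbraid' (by omega)).symm
      · rw [mul_pow_three_eq_one_iff_of_involutive (hsq _ (by omega)) (hsq _ (by omega))]
        rcases h3 with h3 | h3
        · rw [show r - (l : ℕ) = r - k + 1 by omega]
          exact hbraid _ (by omega) (by omega)
        · rw [show r - (k : ℕ) = r - l + 1 by omega]
          exact (hbraid _ (by omega) (by omega)).symm
      · rw [mul_pow_two_eq_one_iff_of_involutive (hsq _ (by omega)) (hsq _ (by omega))]
        have h4 : (k : ℕ) ≠ l := fun h => h1 (Fin.ext h)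
        rcases lt_or_gt_of_ne h4 with h | h
        · exact (hcomm _ _ (by omega) (by omega)).symm
        · exact hcomm _ _ (by omega) (by omega)
    refine ⟨cs.lift ⟨_, hlift⟩, fun i hi => ?_⟩
    rw [cs.lift_apply_simple hlift]
    congr 1
    simp; omega

end CoxeterGroups

/-- Let `τ ≠ Id` be the nontrivial diagram involution of the Dynkin diagram of
type `A_{2r+1}` (vertices labeled `-r, …, -1, 0, 1, …, r`, here realised as `Fin (2r+1)` via
`k ↦ k - r`, so that `τ` is `k ↦ 2r - k`).  Then the restricted Weyl group
`W_τ = { w ∈ W(A_{2r+1}) | τ w = w τ }` is generated by the elements `bs_0 = s_0` and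
`bs_i = s_i s_{-i}` (`1 ≤ i ≤ r`), and is isomorphic to the Weyl group of type `B_{r+1}`. -/
theorem restrictedWeylGroup_A_odd_iso_B
    (r : ℕ) {W W' : Type*} [Group W] [Group W']
    (cs : CoxeterSystem (CoxeterMatrix.Aₙ (2 * r + 1)) W)
    (cs' : CoxeterSystem (CoxeterMatrix.Bₙ (r + 1)) W')
    (τW : W ≃* W)
    (hτW : ∀ k : Fin (2 * r + 1),
      τW (cs.simple k) = cs.simple ⟨2 * r - (k : ℕ), by have := k.isLt; omega⟩) :
    MonoidHom.eqLocus τW.toMonoidHom (MonoidHom.id W)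
      = Subgroup.closure (Set.range (fun i : Fin (r + 1) =>
          if (i : ℕ) = 0 then cs.simple ⟨r, by omega⟩
          else cs.simple ⟨r + (i : ℕ), by have := i.isLt; omega⟩ *
               cs.simple ⟨r - (i : ℕ), by omega⟩))
    ∧ Nonempty ((MonoidHom.eqLocus τW.toMonoidHom (MonoidHom.id W)) ≃* W') := by
  obtain ⟨s, hs, hsq, hcomm, hbraid, ρ, hρ⟩ := exists_typeA_presentation cs
  obtain ⟨b', hgen, hsq', hcomm', hbraid', hbraid₀', hlift⟩ := exists_typeB_presentation cs'
  let b : ℕ → W := fun i => if i = 0 then s 0 else s i * s (-i)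
  have hb0 : b 0 = s 0 := rfl
  have hb : ∀ i, 1 ≤ i → b i = s i * s (-i) := fun i hi => if_neg (by omega)
  obtain ⟨bsq, bcomm, bbraid, bbraid₀⟩ :=
    typeB_relations_of_typeA_relations hb0 hb hsq hcomm hbraid
  obtain ⟨φ, hφ⟩ := hlift W b bsq bcomm bbraid bbraid₀
  have hsimple : ∀ (i : ℤ) (n : ℕ) (hn : n < 2 * r + 1), i = n - r → s i = cs.simple ⟨n, hn⟩ := by
    rintro _ n hn rfl
    exact hs ⟨n, hn⟩
  have hclosure : Subgroup.closure (s '' Set.Ico (-(r : ℤ)) (r + 1)) = ⊤ := by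
    rw [eq_top_iff, ← cs.subgroup_closure_range_simple]
    refine Subgroup.closure_mono ?_
    rintro _ ⟨k, rfl⟩
    exact ⟨k - r, ⟨by omega, by omega⟩, hs k⟩
  have hinj : Function.Injective ρ := (injective_iff_map_eq_one ρ).2 fun w hw =>
    eq_one_of_typeA_relations ρ hsq hcomm hbraid hρ (r + 1) (by omega) le_rfl w
      (hclosure ▸ Subgroup.mem_top w) hw
  have hρb : ∀ i < r + 1, ∀ y : ℤ, ρ (b i) y = if y = i then (i : ℤ) + 1
      else if y = i + 1 then (i : ℤ) else if y = -i then -(i : ℤ) + 1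
      else if y = -i + 1 then -(i : ℤ) else y := by
    intro i hi y
    rcases Nat.eq_zero_or_pos i with rfl | hi0
    · rw [hb0, hρ 0 (by omega) (by omega), Equiv.swap_apply_def]
      split_ifs <;> omega
    · rw [hb i hi0, map_mul, hρ _ (by omega) (by omega), hρ _ (by omega) (by omega),
        Equiv.Perm.mul_apply, Equiv.swap_apply_def, Equiv.swap_apply_def]
      split_ifs <;> omega
  have hφinj : Function.Injective φ := (injective_iff_map_eq_one φ).2 fun w hw =>
    eq_one_of_typeB_relations (ρ.comp φ) hsq' hcomm' hbraid' hbraid₀'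
      (fun i hi y => by rw [MonoidHom.comp_apply, hφ i hi, hρb i hi]) (r + 1) le_rfl w
      (hgen ▸ Subgroup.mem_top w) (by simp [hw])
  have hrange : φ.range = Subgroup.closure (b '' Set.Iio (r + 1)) := by
    rw [MonoidHom.range_eq_map, ← hgen, MonoidHom.map_closure, Set.image_image]
    exact congrArg _ (Set.image_congr fun i hi => hφ i hi)
  have hτs : ∀ i, -(r : ℤ) ≤ i → i < r + 1 → τW (s i) = s (-i) := by
    intro i h1 h2
    rw [hsimple i (i + r).toNat (by omega) (by omega), hτW]
    exact (hsimple _ _ _ (by simp only; omega)).symm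
  have hτρ : ∀ w y, ρ (τW w) (1 - y) = 1 - ρ w y := by
    intro w
    have hw : w ∈ Subgroup.closure (s '' Set.Ico (-(r : ℤ)) (r + 1)) := hclosure ▸ Subgroup.mem_top w
    induction hw using Subgroup.closure_induction with
    | one => simp
    | mem _ h =>
      obtain ⟨i, ⟨h1, h2⟩, rfl⟩ := h
      intro y
      rw [hτs i h1 h2, hρ _ (by omega) (by omega), hρ _ h1 h2, Equiv.swap_apply_def,
        Equiv.swap_apply_def]
      split_ifs <;> omega
    | mul u v _ _ hu hv => intro y; simp [hu, hv]
    | inv u _ hu =>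
      intro y
      rw [map_inv, map_inv, map_inv, Equiv.Perm.inv_eq_iff_eq, hu]
      simp
  have hout : ∀ w (y : ℤ), ((r + 1 : ℕ) : ℤ) < y → ρ w y = y := by
    intro w
    have hw : w ∈ Subgroup.closure (s '' Set.Ico (-(r : ℤ)) (r + 1)) := hclosure ▸ Subgroup.mem_top w
    induction hw using Subgroup.closure_induction with
    | one => simp
    | mem _ h =>
      obtain ⟨i, ⟨h1, h2⟩, rfl⟩ := h
      intro y hy
      push_cast at hy
      rw [hρ _ h1 h2, Equiv.swap_apply_of_ne_of_ne (by omega) (by omega)]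
    | mul u v _ _ hu hv => intro y hy; rw [map_mul, Equiv.Perm.mul_apply, hv y hy, hu y hy]
    | inv u _ hu => intro y hy; rw [map_inv, Equiv.Perm.inv_eq_iff_eq, hu y hy]
  have hfixed : MonoidHom.eqLocus τW.toMonoidHom (MonoidHom.id W)
      = Subgroup.closure (b '' Set.Iio (r + 1)) := by
    apply le_antisymm
    · intro w hw
      have hw' : τW w = w := hw
      refine mem_closure_of_commutes_with_reversal ρ hρb hinj (r + 1) le_rfl w (fun y => ?_)
        (hout w)
      rw [← hτρ, hw']
    · rw [Subgroup.closure_le]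
      rintro _ ⟨i, hi, rfl⟩
      rw [Set.mem_Iio] at hi
      change τW (b i) = b i
      rcases Nat.eq_zero_or_pos i with rfl | hi0
      · rw [hb0, hτs 0 (by omega) (by omega), neg_zero]
      · rw [hb i hi0, map_mul, hτs _ (by omega) (by omega), hτs _ (by omega) (by omega), neg_neg]
        exact hcomm _ _ (by omega) (by omega) (by omega)
  refine ⟨?_, ⟨((MonoidHom.ofInjective hφinj).trans
    (MulEquiv.subgroupCongr (hrange.trans hfixed.symm))).symm⟩⟩
  rw [hfixed]
  have hval : ∀ i : Fin (r + 1), (if (i : ℕ) = 0 then cs.simple ⟨r, by omega⟩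
      else cs.simple ⟨r + (i : ℕ), by have := i.isLt; omega⟩ *
        cs.simple ⟨r - (i : ℕ), by omega⟩) = b i := by
    intro i
    simp only [b]
    split_ifs with h
    · exact (hsimple _ _ _ (by simp)).symm
    · rw [hsimple i (r + i) (by omega) (by push_cast; ring), hsimple (-i) (r - i) (by omega)
        (by omega)]
  congr 1
  ext w
  constructor
  · rintro ⟨i, hi, rfl⟩
    exact ⟨⟨i, hi⟩, hval ⟨i, hi⟩⟩
  · rintro ⟨i, rfl⟩
    exact ⟨i, i.isLt, (hval i).symm⟩
end

section
/- Let A be a finite-dimensional algebra, T a tilting A-module of projective dimension at most 1, and B = End_A(T)^{op}. Then the functor Hom_A(T,−) restricts to an equivalence between the subcategory T = { X : Ext¹_A(T, X) = 0 } of mod(A) and the subcategory Y = { Y : Tor₁^B(T, Y) = 0 } of mod(B), with quasi-inverse T ⊗_B −. -/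
open TensorProduct

universe u

/-- `Ext¹_A(X, Y) = 0`: every short exact sequence `0 → Y → E → X → 0` splits. -/
def Ext1Vanish (A : Type u) [Ring A] (X : Type u) [AddCommGroup X] [Module A X]
    (Y : Type u) [AddCommGroup Y] [Module A Y] : Prop :=
  ∀ (E : Type u) [AddCommGroup E] [Module A E],
    ∀ (i : Y →ₗ[A] E) (p : E →ₗ[A] X), Function.Injective i → Function.Surjective p →
      LinearMap.range i = LinearMap.ker p →
      ∃ s : X →ₗ[A] E, p ∘ₗ s = LinearMap.id

/-- `X ∈ add T`: `X` is a direct summand of a finite direct sum of copies of `T`. -/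
def InAdd (A : Type u) [Ring A] (T : Type u) [AddCommGroup T] [Module A T]
    (X : Type u) [AddCommGroup X] [Module A X] : Prop :=
  ∃ (n : ℕ) (i : X →ₗ[A] (Fin n → T)) (p : (Fin n → T) →ₗ[A] X), p ∘ₗ i = LinearMap.id

/-- `Tor₁^B(T, Y) = 0` where `B = End_A(T)ᵒᵖ`, `T` is a right `B`-module (i.e. a left
`End_A(T)`-module by evaluation) and `Y` is a left `B`-module, i.e. a right
`End_A(T)`-module via the action `act`.  It is expressed via free presentations of `Y`:
for every exact sequence `B^{n2} → B^{n1} → B^{n0} → Y → 0` of right `End_A(T)`-modules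
(the maps given by left-multiplication matrices `d2`, `d1`), the induced sequence
`T^{n2} → T^{n1} → T^{n0}` is exact at `T^{n1}`. -/
def Tor1Vanish (A : Type u) [Ring A] (T : Type u) [AddCommGroup T] [Module A T]
    (Y : Type u) [AddCommGroup Y] (act : Module.End A T → Y → Y) : Prop :=
  ∀ (n0 n1 n2 : ℕ)
    (q : (Fin n0 → Module.End A T) → Y)
    (d1 : Matrix (Fin n0) (Fin n1) (Module.End A T))
    (d2 : Matrix (Fin n1) (Fin n2) (Module.End A T)),
    (∀ x y, q (x + y) = q x + q y) →
    (∀ (φ : Module.End A T) (x), q (fun i => x i * φ) = act φ (q x)) →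
    Function.Surjective q →
    (∀ x : Fin n0 → Module.End A T,
      q x = 0 ↔ ∃ y : Fin n1 → Module.End A T, (fun j => ∑ i, d1 j i * y i) = x) →
    (∀ x : Fin n1 → Module.End A T,
      (fun j => ∑ i, d1 j i * x i) = (0 : Fin n0 → Module.End A T)
        ↔ ∃ y : Fin n2 → Module.End A T, (fun j => ∑ i, d2 j i * y i) = x) →
    ∀ u : Fin n1 → T, (∀ j, ∑ i, (d1 j i) (u i) = 0) →
      ∃ w : Fin n2 → T, ∀ j, ∑ i, (d2 j i) (w i) = u j

/-- The evaluation pairing `T × Hom_A(T, X) → X`, as a `k`-bilinear map. -/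
def evB (k : Type u) [Field k] (A : Type u) [Ring A] [Algebra k A]
    (T : Type u) [AddCommGroup T] [Module k T] [Module A T] [IsScalarTower k A T]
    [SMulCommClass A k T]
    (X : Type u) [AddCommGroup X] [Module k X] [Module A X] [IsScalarTower k A X]
    [SMulCommClass A k X] :
    T →ₗ[k] ((T →ₗ[A] X) →ₗ[k] X) :=
  LinearMap.mk₂ k (fun tt f => f tt)
    (fun m₁ m₂ f => map_add f m₁ m₂)
    (fun cst m f => f.map_smul_of_tower cst m)
    (fun _ _ _ => rfl)
    (fun _ _ _ => rfl)

section Tilting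

variable {A : Type u} [Ring A]

section General

variable {M N X Z : Type u} [AddCommGroup M] [Module A M] [AddCommGroup N] [Module A N]
  [AddCommGroup X] [Module A X] [AddCommGroup Z] [Module A Z]

/-- A linear map with values in the range of an injective map factors through it. -/
theorem exists_comp_eq_of_injective (i : X →ₗ[A] N) (hi : Function.Injective i)
    (f : M →ₗ[A] N) (hf : ∀ m, f m ∈ LinearMap.range i) :
    ∃ g : M →ₗ[A] X, ∀ m, i (g m) = f m := by
  refine ⟨(LinearEquiv.ofInjective i hi).symm.toLinearMap ∘ₗ f.codRestrict _ hf, fun m => ?_⟩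
  have := (LinearEquiv.ofInjective i hi).apply_symm_apply (f.codRestrict _ hf m)
  exact congrArg Subtype.val this

/-- A linear map vanishing on the kernel of a surjective map factors through it. -/
theorem exists_comp_eq_of_surjective (p : M →ₗ[A] N) (hp : Function.Surjective p)
    (f : M →ₗ[A] X) (hf : ∀ m, p m = 0 → f m = 0) :
    ∃ g : N →ₗ[A] X, ∀ m, g (p m) = f m := by
  refine ⟨(LinearMap.ker p).liftQ f hf ∘ₗ (p.quotKerEquivOfSurjective hp).symm.toLinearMap,
    fun m => ?_⟩
  have : (p.quotKerEquivOfSurjective hp).symm (p m) = (LinearMap.ker p).mkQ m := by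
    rw [LinearEquiv.symm_apply_eq]
    rfl
  rw [LinearMap.comp_apply, LinearEquiv.coe_coe, this]
  rfl

/-- If `Ext¹(Z, X) = 0`, linear maps to `X` extend along the kernel of any surjection to `Z`. -/
theorem Ext1Vanish.exists_extension (hZ : Ext1Vanish A Z X) (p : M →ₗ[A] Z)
    (hp : Function.Surjective p) (h : LinearMap.ker p →ₗ[A] X) :
    ∃ g : M →ₗ[A] X, ∀ x : LinearMap.ker p, g x = h x := by
  let S : Submodule A (X × M) :=
    LinearMap.range (h.prod (-(LinearMap.ker p).subtype))
  let i : X →ₗ[A] (X × M) ⧸ S := S.mkQ ∘ₗ LinearMap.inl A X M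
  let r : M →ₗ[A] (X × M) ⧸ S := S.mkQ ∘ₗ LinearMap.inr A X M
  have hr : ∀ x : LinearMap.ker p, r x = i (h x) := by
    intro x
    symm
    refine (Submodule.Quotient.eq S).2 ⟨x, ?_⟩
    simp
  let π : (X × M) ⧸ S →ₗ[A] Z := S.liftQ (p ∘ₗ LinearMap.snd A X M) (by
    rintro _ ⟨x, rfl⟩
    simp)
  have hπ : ∀ x m, π (S.mkQ (x, m)) = p m := fun x m => rfl
  have hmk : ∀ x m, S.mkQ (x, m) = i x + r m := fun x m => by
    simp only [i, r, LinearMap.comp_apply, ← map_add]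
    simp
  have hi : Function.Injective i := by
    refine (injective_iff_map_eq_zero i).2 fun x hx => ?_
    obtain ⟨y, hy⟩ := (Submodule.Quotient.mk_eq_zero S).1 hx
    have h2 : y = 0 := by
      have := congrArg Prod.snd hy
      simpa using this
    have h1 := congrArg Prod.fst hy
    simpa [h2] using h1.symm
  have hrange : LinearMap.range i = LinearMap.ker π := by
    ext e
    constructor
    · rintro ⟨x, rfl⟩
      exact (hπ x 0).trans (map_zero p)
    · intro he
      obtain ⟨⟨x, m⟩, rfl⟩ := S.mkQ_surjective e
      have hm : p m = 0 := he
      exact ⟨x + h ⟨m, hm⟩, by rw [hmk, map_add, ← hr]⟩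
  have hsurj : Function.Surjective π := fun z => by
    obtain ⟨m, rfl⟩ := hp z
    exact ⟨S.mkQ (0, m), hπ 0 m⟩
  obtain ⟨s, hs⟩ := hZ _ i π hi hsurj hrange
  obtain ⟨g, hg⟩ := exists_comp_eq_of_injective i hi (r - s ∘ₗ p) (fun m => by
    rw [hrange, LinearMap.mem_ker, LinearMap.sub_apply, map_sub, LinearMap.comp_apply s p,
      ← LinearMap.comp_apply π s, hs]
    exact sub_eq_zero.2 (hπ 0 m))
  refine ⟨g, fun x => hi ?_⟩
  rw [hg, ← hr]
  simp

end General

section Presentation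

variable {P T : Type u} [AddCommGroup P] [Module A P] [AddCommGroup T] [Module A T]
  {M N X : Type u} [AddCommGroup M] [Module A M] [AddCommGroup N] [Module A N]
  [AddCommGroup X] [Module A X]

/-- Every linear map from the kernel of `π` to `X` extends to the source of `π`.  If `π` is a
surjection from a projective module to `T`, this says that `Ext¹(T, X) = 0`. -/
def ExtendsFromKer (π : P →ₗ[A] T) (X : Type u) [AddCommGroup X] [Module A X] : Prop :=
  ∀ h : LinearMap.ker π →ₗ[A] X, ∃ g : P →ₗ[A] X, ∀ x : LinearMap.ker π, g x = h x

variable {π : P →ₗ[A] T}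

theorem ExtendsFromKer.pi {n : ℕ} (hX : ExtendsFromKer π X) :
    ExtendsFromKer π (Fin n → X) := by
  intro h
  choose g hg using fun i => hX (LinearMap.proj i ∘ₗ h)
  exact ⟨LinearMap.pi g, fun x => funext fun i => hg i x⟩

theorem ExtendsFromKer.of_surjective [Module.Projective A (LinearMap.ker π)]
    (hM : ExtendsFromKer π M) (p : M →ₗ[A] X) (hp : Function.Surjective p) :
    ExtendsFromKer π X := by
  intro h
  obtain ⟨h', hh'⟩ := Module.projective_lifting_property p h hp
  obtain ⟨g, hg⟩ := hM h'
  refine ⟨p ∘ₗ g, fun x => ?_⟩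
  rw [LinearMap.comp_apply, hg, ← hh', LinearMap.comp_apply]

theorem ExtendsFromKer.exists_lift [Module.Projective A P] (hπ : Function.Surjective π)
    (i : X →ₗ[A] M) (hi : Function.Injective i) (hX : ExtendsFromKer π X)
    (p : M →ₗ[A] N) (hp : Function.Surjective p) (hip : LinearMap.range i = LinearMap.ker p)
    (f : T →ₗ[A] N) : ∃ g : T →ₗ[A] M, ∀ t, p (g t) = f t := by
  obtain ⟨e, he⟩ := Module.projective_lifting_property p (f ∘ₗ π) hp
  have he' : ∀ x, p (e x) = f (π x) := fun x => LinearMap.congr_fun he x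
  obtain ⟨h, hh⟩ := exists_comp_eq_of_injective i hi (e ∘ₗ (LinearMap.ker π).subtype)
    (fun x => by
      rw [hip, LinearMap.mem_ker, LinearMap.comp_apply, he', Submodule.subtype_apply,
        LinearMap.mem_ker.1 x.2, map_zero])
  obtain ⟨e', hee'⟩ := hX h
  obtain ⟨g, hg⟩ := exists_comp_eq_of_surjective π hπ (e - i ∘ₗ e') (fun x hx => by
    have h1 := hee' ⟨x, hx⟩
    have h2 := hh ⟨x, hx⟩
    simp only [LinearMap.comp_apply, Submodule.subtype_apply] at h1 h2
    rw [LinearMap.sub_apply, LinearMap.comp_apply, h1, h2, sub_self])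
  refine ⟨g, fun t => ?_⟩
  obtain ⟨x, rfl⟩ := hπ t
  have : p (i (e' x)) = 0 := by
    rw [← LinearMap.mem_ker, ← hip]
    exact ⟨_, rfl⟩
  rw [hg, LinearMap.sub_apply, map_sub, he', LinearMap.comp_apply, this, sub_zero]

theorem ExtendsFromKer.exists_lift_ker [Module.Projective A P] (hπ : Function.Surjective π)
    (p : M →ₗ[A] N) (hp : Function.Surjective p) (hX : ExtendsFromKer π (LinearMap.ker p))
    (f : T →ₗ[A] N) : ∃ g : T →ₗ[A] M, ∀ t, p (g t) = f t :=
  hX.exists_lift hπ (LinearMap.ker p).subtype (Submodule.subtype_injective _) p hp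
    (Submodule.range_subtype _) f

/-- The kernel of an approximation `M → N` by `T` inherits the vanishing of `Ext¹(T, -)`. -/
theorem ExtendsFromKer.ker (hπ : Function.Surjective π) (hM : ExtendsFromKer π M)
    (p : M →ₗ[A] N)
    (hp : ∀ f : T →ₗ[A] N, (∀ t, f t ∈ LinearMap.range p) →
      ∃ g : T →ₗ[A] M, ∀ t, p (g t) = f t) :
    ExtendsFromKer π (LinearMap.ker p) := by
  intro h
  obtain ⟨e, he⟩ := hM ((LinearMap.ker p).subtype ∘ₗ h)
  obtain ⟨f, hf⟩ := exists_comp_eq_of_surjective π hπ (p ∘ₗ e) (fun x hx => by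
    have h1 := he ⟨x, hx⟩
    simp only [LinearMap.comp_apply, Submodule.subtype_apply] at h1
    rw [LinearMap.comp_apply, h1]
    exact (h ⟨x, hx⟩).2)
  obtain ⟨g, hg⟩ := hp f (fun t => by
    obtain ⟨x, rfl⟩ := hπ t
    exact ⟨e x, (hf x).symm⟩)
  refine ⟨(e - g ∘ₗ π).codRestrict _ (fun x => ?_), fun x => Subtype.ext ?_⟩
  · rw [LinearMap.mem_ker, LinearMap.sub_apply, map_sub, LinearMap.comp_apply, hg, hf,
      LinearMap.comp_apply, sub_self]
  · have h1 := he x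
    simp only [LinearMap.comp_apply, Submodule.subtype_apply] at h1
    rw [LinearMap.codRestrict_apply, LinearMap.sub_apply, h1, LinearMap.comp_apply,
      LinearMap.mem_ker.1 x.2, map_zero, sub_zero]

theorem ExtendsFromKer.ext1Vanish [Module.Projective A P] (hπ : Function.Surjective π)
    (hX : ExtendsFromKer π X) : Ext1Vanish A T X := by
  intro E _ _ i p hi hp hip
  obtain ⟨s, hs⟩ := hX.exists_lift hπ i hi p hp hip LinearMap.id
  exact ⟨s, LinearMap.ext hs⟩

theorem ExtendsFromKer.ext1Vanish_of_inAdd [Module.Projective A P]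
    (hπ : Function.Surjective π) (hX : ExtendsFromKer π X) (hN : InAdd A T N) :
    Ext1Vanish A N X := by
  intro E _ _ i p hi hp hip
  obtain ⟨n, ι, ρ, hρ⟩ := hN
  choose s hs using fun l : Fin n =>
    hX.exists_lift hπ i hi p hp hip (ρ ∘ₗ LinearMap.single A (fun _ => T) l)
  have hs' : p ∘ₗ LinearMap.lsum A (fun _ => T) ℕ s = ρ := by
    refine LinearMap.pi_ext' fun l => LinearMap.ext fun t => ?_
    simpa [LinearMap.lsum_apply, Pi.single_apply, apply_ite] using hs l t
  exact ⟨LinearMap.lsum A (fun _ => T) ℕ s ∘ₗ ι, by rw [← LinearMap.comp_assoc, hs', hρ]⟩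

/-- A module `X` with `Ext¹(T, X) = 0` is generated by `T`, with fixed elements of `T`. -/
theorem ExtendsFromKer.exists_eq_sum [Module.Projective A P] (hπ : Function.Surjective π)
    (hX : ExtendsFromKer π X) {m : ℕ} (j : A →ₗ[A] (Fin m → T)) (hj : Function.Injective j)
    (hT : InAdd A T ((Fin m → T) ⧸ LinearMap.range j)) (x : X) :
    ∃ g : Fin m → (T →ₗ[A] X), x = ∑ l, g l (j 1 l) := by
  have hmem : ∀ y ∈ LinearMap.ker (LinearMap.range j).mkQ, y ∈ LinearMap.range j := by
    intro y hy
    rwa [Submodule.ker_mkQ] at hy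
  obtain ⟨c, hc⟩ := exists_comp_eq_of_injective j hj
    (LinearMap.ker (LinearMap.range j).mkQ).subtype (fun y => hmem _ y.2)
  obtain ⟨g, hg⟩ := (hX.ext1Vanish_of_inAdd hπ hT).exists_extension
    (LinearMap.range j).mkQ (Submodule.mkQ_surjective _)
    (LinearMap.toSpanSingleton A X x ∘ₗ c)
  refine ⟨fun l => g ∘ₗ LinearMap.single A (fun _ => T) l, ?_⟩
  have h1 : j 1 ∈ LinearMap.ker (LinearMap.range j).mkQ := by
    rw [Submodule.ker_mkQ]
    exact ⟨1, rfl⟩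
  have h2 : c ⟨j 1, h1⟩ = 1 := hj (hc ⟨j 1, h1⟩)
  have h3 : g (j 1) = x := by
    rw [hg ⟨j 1, h1⟩]
    simp [h2]
  rw [← h3]
  conv_lhs => rw [← Finset.univ_sum_single (j 1)]
  rw [map_sum]
  rfl

end Presentation

section Matrices

variable {T X : Type u} [AddCommGroup T] [Module A T] [AddCommGroup X] [Module A X]

/-- The map `Tⁿ → X` given by a row of maps `T → X`. -/
def rowMap {n : ℕ} (f : Fin n → (T →ₗ[A] X)) : (Fin n → T) →ₗ[A] X :=
  ∑ i, f i ∘ₗ LinearMap.proj i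

theorem rowMap_apply {n : ℕ} (f : Fin n → (T →ₗ[A] X)) (t : Fin n → T) :
    rowMap f t = ∑ i, f i (t i) := by
  simp [rowMap]

/-- The map `Tⁿ → Tᵐ` given by a matrix over the endomorphism ring of `T`. -/
def matrixMap {m n : ℕ} (d : Matrix (Fin m) (Fin n) (Module.End A T)) :
    (Fin n → T) →ₗ[A] (Fin m → T) :=
  LinearMap.pi fun j => rowMap (d j)

theorem matrixMap_apply {m n : ℕ} (d : Matrix (Fin m) (Fin n) (Module.End A T))
    (t : Fin n → T) (j : Fin m) : matrixMap d t j = ∑ i, d j i (t i) :=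
  rowMap_apply _ _

theorem matrixMap_pi {m n : ℕ} (d : Matrix (Fin m) (Fin n) (Module.End A T))
    (y : Fin n → Module.End A T) (t : T) :
    matrixMap d (LinearMap.pi y t) = LinearMap.pi (fun j => ∑ i, d j i * y i) t := by
  ext j
  simp [matrixMap_apply]

theorem matrixMap_single {m n : ℕ} (d : Matrix (Fin m) (Fin n) (Module.End A T)) (i : Fin n)
    (t : T) : matrixMap d (Pi.single i t) = LinearMap.pi (fun l => d l i) t := by
  funext l
  rw [matrixMap_apply, Finset.sum_eq_single i]
  · simp
  · intro b _ hb
    simp [hb]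
  · simp

theorem rowMap_pi {n : ℕ} (f : Fin n → (T →ₗ[A] X)) (y : Fin n → Module.End A T) (t : T) :
    rowMap f (LinearMap.pi y t) = (∑ i, f i ∘ₗ y i) t := by
  simp [rowMap_apply]

theorem pi_proj {n : ℕ} (g : T →ₗ[A] (Fin n → T)) :
    LinearMap.pi (fun i => LinearMap.proj i ∘ₗ g) = g := rfl

end Matrices

section FiniteDimensional

variable {k : Type u} [Field k] {T X : Type u} [AddCommGroup T] [Module k T] [Module A T]
  [FiniteDimensional k T]
  [AddCommGroup X] [Module k X] [Module A X] [SMulCommClass A k X] [FiniteDimensional k X]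

theorem finiteDimensional_linearMap [Algebra k A] [IsScalarTower k A T] [IsScalarTower k A X] :
    FiniteDimensional k (T →ₗ[A] X) :=
  Module.Finite.of_injective (LinearMap.restrictScalarsₗ k A T X k)
    (LinearMap.restrictScalars_injective k)

theorem exists_generators_linearMap [SMulCommClass A k T] [Algebra k A] [IsScalarTower k A T]
    [IsScalarTower k A X] :
    ∃ (n : ℕ) (f : Fin n → (T →ₗ[A] X)), ∀ h : T →ₗ[A] X,
      ∃ y : Fin n → Module.End A T, h = ∑ i, f i ∘ₗ y i := by
  have := finiteDimensional_linearMap (k := k) (A := A) (T := T) (X := X)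
  let b := Module.finBasis k (T →ₗ[A] X)
  refine ⟨_, b, fun h => ⟨fun i => b.repr h i • LinearMap.id, ?_⟩⟩
  conv_lhs => rw [← b.sum_repr h]
  refine Finset.sum_congr rfl fun i _ => LinearMap.ext fun t => ?_
  simp [LinearMap.map_smul_of_tower]

/-- A right submodule of `End(T)ⁿ` is the column space of a matrix. -/
theorem exists_matrix_of_right_submodule (k : Type u) [Field k] [Module k T]
    [FiniteDimensional k T] [SMulCommClass A k T] [Algebra k A] [IsScalarTower k A T] {n : ℕ}
    (S : AddSubgroup (Fin n → Module.End A T))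
    (hS : ∀ x ∈ S, ∀ φ : Module.End A T, (fun i => x i * φ) ∈ S) :
    ∃ (m : ℕ) (d : Matrix (Fin n) (Fin m) (Module.End A T)), ∀ x,
      x ∈ S ↔ ∃ y : Fin m → Module.End A T, (fun j => ∑ i, d j i * y i) = x := by
  have : FiniteDimensional k (Module.End A T) := finiteDimensional_linearMap
  let V : Submodule k (Fin n → Module.End A T) :=
    { S with
      smul_mem' := fun c x hx => by
        have := hS x hx (c • 1)
        have h : c • x = fun i => x i * (c • 1) := by
          funext i
          simp
        exact h ▸ this }
  let b := Module.finBasis k V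
  refine ⟨_, fun j i => (b i : Fin n → Module.End A T) j, fun x => ⟨fun hx => ?_, ?_⟩⟩
  · refine ⟨fun i => b.repr ⟨x, hx⟩ i • 1, ?_⟩
    have h1 := congrArg (Subtype.val) (b.sum_repr ⟨x, hx⟩)
    rw [AddSubmonoidClass.coe_finsetSum] at h1
    funext j
    refine Eq.trans ?_ (congrFun h1 j)
    simp
  · rintro ⟨y, rfl⟩
    have h1 : (fun j => ∑ i, (b i : Fin n → Module.End A T) j * y i)
        = ∑ i, fun j => (b i : Fin n → Module.End A T) j * y i := by
      funext j
      simp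
    rw [h1]
    exact S.sum_mem fun i _ => hS _ (b i).2 _

end FiniteDimensional


section Equivalence

variable {P T : Type u} [AddCommGroup P] [Module A P] [AddCommGroup T] [Module A T]
  {X : Type u} [AddCommGroup X] [Module A X] {π : P →ₗ[A] T}
  {m : ℕ} {j : A →ₗ[A] (Fin m → T)}

/-- Relations in `X` between images of elements of `T` under generators of `Hom(T, X)` come from
relations between these generators. -/
theorem ExtendsFromKer.exists_relations [Module.Projective A P] (hπ : Function.Surjective π)
    (hT : ExtendsFromKer π T) (hj : Function.Injective j)
    (hadd : InAdd A T ((Fin m → T) ⧸ LinearMap.range j)) {n : ℕ} (f : Fin n → (T →ₗ[A] X))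
    (hf : ∀ h : T →ₗ[A] X, ∃ y : Fin n → Module.End A T, h = ∑ i, f i ∘ₗ y i)
    (t : Fin n → T) (ht : ∑ i, f i (t i) = 0) :
    ∃ κ : Fin m → Fin n → Module.End A T, (∀ i, t i = ∑ l, κ l i (j 1 l)) ∧
      ∀ l, ∑ i, f i ∘ₗ κ l i = 0 := by
  have hK : ExtendsFromKer π (LinearMap.ker (rowMap f)) :=
    ExtendsFromKer.ker hπ hT.pi _ fun h _ => by
      obtain ⟨y, rfl⟩ := hf h
      exact ⟨LinearMap.pi y, rowMap_pi f y⟩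
  obtain ⟨g, hg⟩ := hK.exists_eq_sum hπ j hj hadd ⟨t, by rwa [LinearMap.mem_ker, rowMap_apply]⟩
  refine ⟨fun l i => LinearMap.proj i ∘ₗ (LinearMap.ker (rowMap f)).subtype ∘ₗ g l,
    fun i => ?_, fun l => LinearMap.ext fun s => ?_⟩
  · have h1 := congrFun (congrArg Subtype.val hg) i
    rw [AddSubmonoidClass.coe_finsetSum, Finset.sum_apply] at h1
    exact h1
  · have h1 := (g l s).2
    rw [LinearMap.mem_ker, rowMap_apply] at h1
    simpa using h1

/-- Any module of the form `Hom(T, X)` has vanishing `Tor₁` with `T`. -/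
theorem tor1Vanish_linearMap [Module.Projective A P] (hπ : Function.Surjective π)
    (hT : ExtendsFromKer π T) (hj : Function.Injective j)
    (hadd : InAdd A T ((Fin m → T) ⧸ LinearMap.range j)) :
    Tor1Vanish A T (T →ₗ[A] X) (fun φ f => f ∘ₗ φ) := by
  intro n0 n1 n2 q d1 d2 hq hqmul _ hq1 hq2 u hu
  let Q : (Fin n0 → Module.End A T) →+ (T →ₗ[A] X) := AddMonoidHom.mk' q hq
  let F := rowMap fun i => q (Pi.single i 1)
  have hF : ∀ (x : Fin n0 → Module.End A T) t, F (LinearMap.pi x t) = q x t := by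
    intro x t
    have hx : q x = ∑ i, q (Pi.single i 1) ∘ₗ x i := by
      conv_lhs => rw [← Finset.univ_sum_single x]
      refine (map_sum Q _ _).trans (Finset.sum_congr rfl fun i _ => ?_)
      refine Eq.trans (congrArg q ?_) (hqmul (x i) (Pi.single i 1))
      funext l
      obtain rfl | h := eq_or_ne l i
      · simp
      · simp [h]
    rw [hx]
    exact rowMap_pi _ x t
  have hFd : ∀ v, F (matrixMap d1 v) = 0 := by
    intro v
    have hcol : ∀ i, F ∘ₗ matrixMap d1 ∘ₗ LinearMap.single A (fun _ => T) i = 0 := by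
      intro i
      ext t
      have h0 := (hq1 (fun l => d1 l i)).2 ⟨Pi.single i 1, by
        funext l
        simp [Pi.single_apply]⟩
      simp only [LinearMap.comp_apply, LinearMap.coe_single, matrixMap_single, hF, h0]
    rw [← Finset.univ_sum_single v, map_sum, map_sum]
    exact Finset.sum_eq_zero fun i _ => LinearMap.congr_fun (hcol i) (v i)
  have hK : ExtendsFromKer π (LinearMap.ker (matrixMap d1)) :=
    ExtendsFromKer.ker hπ hT.pi _ fun f hf => by
      obtain ⟨y, hy⟩ := (hq1 (fun i => LinearMap.proj i ∘ₗ f)).1 <| LinearMap.ext fun t => by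
        rw [← hF, pi_proj]
        obtain ⟨v, hv⟩ := hf t
        rw [← hv, hFd, LinearMap.zero_apply]
      refine ⟨LinearMap.pi y, fun t => ?_⟩
      rw [matrixMap_pi, hy, pi_proj]
  obtain ⟨g, hg⟩ := hK.exists_eq_sum hπ j hj hadd
    ⟨u, by rw [LinearMap.mem_ker]; funext l; rw [matrixMap_apply, hu, Pi.zero_apply]⟩
  have hy : ∀ l, ∃ y : Fin n2 → Module.End A T, ∀ t, matrixMap d2 (LinearMap.pi y t) = g l t := by
    intro l
    obtain ⟨y, hy⟩ := (hq2 (fun i => LinearMap.proj i ∘ₗ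
      (LinearMap.ker (matrixMap d1)).subtype ∘ₗ g l)).1 <| funext fun i =>
        LinearMap.ext fun t => by
          have h1 := congrFun (LinearMap.mem_ker.1 (g l t).2) i
          rw [matrixMap_apply] at h1
          simpa using h1
    refine ⟨y, fun t => ?_⟩
    rw [matrixMap_pi, hy]
    rfl
  choose y hy using hy
  refine ⟨∑ l, LinearMap.pi (y l) (j 1 l), fun i => ?_⟩
  rw [← matrixMap_apply, map_sum]
  simp only [hy]
  have h1 := congrFun (congrArg Subtype.val hg) i
  rw [AddSubmonoidClass.coe_finsetSum] at h1
  exact h1.symm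

theorem ExtendsFromKer.rowMap_surjective [Module.Projective A P] (hπ : Function.Surjective π)
    (hX : ExtendsFromKer π X) (hj : Function.Injective j)
    (hadd : InAdd A T ((Fin m → T) ⧸ LinearMap.range j)) {n : ℕ} (f : Fin n → (T →ₗ[A] X))
    (hf : ∀ h : T →ₗ[A] X, ∃ y : Fin n → Module.End A T, h = ∑ i, f i ∘ₗ y i) :
    Function.Surjective (rowMap f) := by
  intro x
  obtain ⟨g, rfl⟩ := hX.exists_eq_sum hπ j hj hadd x
  choose y hy using fun l => hf (g l)
  refine ⟨∑ l, LinearMap.pi (y l) (j 1 l), ?_⟩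
  rw [map_sum]
  exact Finset.sum_congr rfl fun l _ => by rw [rowMap_pi, ← hy]

/-- `Hom(T, -)` is full on modules `X` with `Ext¹(T, X) = 0`. -/
theorem ExtendsFromKer.exists_eq_comp [Module.Projective A P] (hπ : Function.Surjective π)
    (hT : ExtendsFromKer π T) (hX : ExtendsFromKer π X) (hj : Function.Injective j)
    (hadd : InAdd A T ((Fin m → T) ⧸ LinearMap.range j)) {n : ℕ} (f : Fin n → (T →ₗ[A] X))
    (hf : ∀ h : T →ₗ[A] X, ∃ y : Fin n → Module.End A T, h = ∑ i, f i ∘ₗ y i)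
    {X' : Type u} [AddCommGroup X'] [Module A X'] (g : (T →ₗ[A] X) → (T →ₗ[A] X'))
    (hadd_g : ∀ f₁ f₂, g (f₁ + f₂) = g f₁ + g f₂)
    (hcomp_g : ∀ (φ : Module.End A T) f, g (f ∘ₗ φ) = g f ∘ₗ φ) :
    ∃ ψ : X →ₗ[A] X', ∀ f, g f = ψ ∘ₗ f := by
  let G : (T →ₗ[A] X) →+ (T →ₗ[A] X') := AddMonoidHom.mk' g hadd_g
  have hG : ∀ y : Fin n → Module.End A T, g (∑ i, f i ∘ₗ y i) = ∑ i, g (f i) ∘ₗ y i := fun y =>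
    (map_sum G _ _).trans (Finset.sum_congr rfl fun i _ => hcomp_g _ _)
  obtain ⟨ψ, hψ⟩ := exists_comp_eq_of_surjective (rowMap f)
    (hX.rowMap_surjective hπ hj hadd f hf) (rowMap fun i => g (f i)) (fun t ht => by
      rw [rowMap_apply] at ht
      obtain ⟨κ, hκ, hκf⟩ := hT.exists_relations hπ hj hadd f hf t ht
      have ht' : t = ∑ l, LinearMap.pi (κ l) (j 1 l) := funext fun i => by
        rw [hκ i, Finset.sum_apply]
        rfl
      rw [ht', map_sum]
      refine Finset.sum_eq_zero fun l _ => ?_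
      rw [rowMap_pi, ← hG, hκf, show g 0 = 0 from map_zero G, LinearMap.zero_apply])
  refine ⟨ψ, fun h => ?_⟩
  obtain ⟨y, rfl⟩ := hf h
  ext t
  rw [hG, ← rowMap_pi, ← hψ, rowMap_pi, LinearMap.comp_apply]

/-- A finitely presented module with vanishing `Tor₁` is of the form `Hom(T, X)`. -/
theorem exists_linearMap_addEquiv [Module.Projective A P]
    [Module.Projective A (LinearMap.ker π)] (hπ : Function.Surjective π)
    (hT : ExtendsFromKer π T) {Y : Type u} [AddCommGroup Y] (act : Module.End A T → Y → Y)
    {n0 n1 n2 : ℕ} (q : (Fin n0 → Module.End A T) →+ Y)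
    (d1 : Matrix (Fin n0) (Fin n1) (Module.End A T))
    (d2 : Matrix (Fin n1) (Fin n2) (Module.End A T))
    (hqmul : ∀ (φ : Module.End A T) (x), q (fun i => x i * φ) = act φ (q x))
    (hqsurj : Function.Surjective q)
    (hq1 : ∀ x : Fin n0 → Module.End A T,
      q x = 0 ↔ ∃ y : Fin n1 → Module.End A T, (fun j => ∑ i, d1 j i * y i) = x)
    (hd : ∀ u : Fin n1 → T, matrixMap d1 u = 0 ↔ ∃ w, matrixMap d2 w = u) :
    ∃ X : ModuleCat.{u} A, Ext1Vanish A T X ∧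
      ∃ ee : (T →ₗ[A] X) ≃+ Y,
        ∀ (φ : Module.End A T) (f : T →ₗ[A] X), ee (f ∘ₗ φ) = act φ (ee f) := by
  let C := LinearMap.range (matrixMap d1)
  have hC : ExtendsFromKer π C :=
    (hT.pi (n := n1)).of_surjective (matrixMap d1).rangeRestrict
      (matrixMap d1).surjective_rangeRestrict
  have hX : ExtendsFromKer π ((Fin n0 → T) ⧸ C) :=
    (hT.pi (n := n0)).of_surjective C.mkQ C.mkQ_surjective
  have hK : ExtendsFromKer π (LinearMap.ker (matrixMap d1).rangeRestrict) := by
    rw [LinearMap.ker_rangeRestrict]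
    have : LinearMap.ker (matrixMap d1) = LinearMap.range (matrixMap d2) :=
      Submodule.ext fun u => hd u
    rw [this]
    exact (hT.pi (n := n2)).of_surjective (matrixMap d2).rangeRestrict
      (matrixMap d2).surjective_rangeRestrict
  let r : (Fin n0 → Module.End A T) →+ (T →ₗ[A] (Fin n0 → T) ⧸ C) :=
    AddMonoidHom.mk' (fun x => C.mkQ ∘ₗ LinearMap.pi x) fun x y => by
      rw [← LinearMap.comp_add]
      rfl
  have hrsurj : Function.Surjective r := by
    intro f
    obtain ⟨g, hg⟩ := hC.exists_lift hπ C.subtype C.subtype_injective C.mkQ C.mkQ_surjective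
      (by rw [Submodule.range_subtype, Submodule.ker_mkQ]) f
    exact ⟨fun i => (LinearMap.proj i : (Fin n0 → T) →ₗ[A] T) ∘ₗ g, LinearMap.ext hg⟩
  have hker : r.ker = q.ker := by
    ext x
    rw [AddMonoidHom.mem_ker, AddMonoidHom.mem_ker, hq1]
    constructor
    · intro hx
      have hmem : ∀ t, LinearMap.pi x t ∈ C := fun t => by
        rw [← Submodule.Quotient.mk_eq_zero]
        exact LinearMap.congr_fun hx t
      obtain ⟨g, hg⟩ := hK.exists_lift_ker hπ (matrixMap d1).rangeRestrict
        (matrixMap d1).surjective_rangeRestrict ((LinearMap.pi x).codRestrict C hmem)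
      refine ⟨fun i => LinearMap.proj i ∘ₗ g, funext fun l => LinearMap.ext fun t => ?_⟩
      have h1 := congrFun (congrArg Subtype.val (hg t)) l
      refine Eq.trans ?_ h1
      exact (congrFun (matrixMap_pi d1 (fun i => LinearMap.proj i ∘ₗ g) t) l).symm
    · rintro ⟨y, rfl⟩
      refine LinearMap.ext fun t => (Submodule.Quotient.mk_eq_zero C).2 ?_
      rw [← matrixMap_pi]
      exact ⟨_, rfl⟩
  let e1 := QuotientAddGroup.quotientKerEquivOfSurjective r hrsurj
  let e2 := QuotientAddGroup.quotientKerEquivOfSurjective q hqsurj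
  let ee := (e1.symm.trans (QuotientAddGroup.quotientAddEquivOfEq hker)).trans e2
  have hee : ∀ x, ee (r x) = q x := by
    intro x
    have h1 : e1.symm (r x) = (x : _ ⧸ r.ker) := by
      rw [AddEquiv.symm_apply_eq]
      rfl
    simp only [ee, AddEquiv.trans_apply, h1]
    rfl
  refine ⟨ModuleCat.of A ((Fin n0 → T) ⧸ C), hX.ext1Vanish hπ, ee, fun φ f => ?_⟩
  obtain ⟨x, rfl⟩ := hrsurj f
  have h1 : r x ∘ₗ φ = r (fun i => x i * φ) := rfl
  exact (congrArg ee h1).trans ((hee _).trans ((hqmul φ x).trans (congrArg _ (hee x).symm)))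

end Equivalence

section Evaluation

variable {k : Type u} [Field k] {T : Type u} [AddCommGroup T] [Module k T] [Module A T]
  {X : Type u} [AddCommGroup X] [Module k X] [Module A X] [SMulCommClass A k X]

variable (A k T X) in
/-- The span of the relations `φ t ⊗ f = t ⊗ f φ` defining the tensor product over `End(T)`. -/
def balancingRelations : Submodule k (T ⊗[k] (T →ₗ[A] X)) :=
  Submodule.span k {z | ∃ (tt : T) (φ : Module.End A T) (f : T →ₗ[A] X),
    z = (φ tt) ⊗ₜ[k] f - tt ⊗ₜ[k] (f ∘ₗ φ)}

theorem mk_tmul_comp (t : T) (φ : Module.End A T) (f : T →ₗ[A] X) :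
    (balancingRelations A k T X).mkQ (t ⊗ₜ[k] (f ∘ₗ φ))
      = (balancingRelations A k T X).mkQ (φ t ⊗ₜ[k] f) :=
  ((Submodule.Quotient.eq (balancingRelations A k T X)).2
    (Submodule.subset_span ⟨t, φ, f, rfl⟩)).symm

theorem exists_mk_eq_sum {n : ℕ} (f : Fin n → (T →ₗ[A] X))
    (hf : ∀ h : T →ₗ[A] X, ∃ y : Fin n → Module.End A T, h = ∑ i, f i ∘ₗ y i)
    (z : T ⊗[k] (T →ₗ[A] X)) :
    ∃ t : Fin n → T, (balancingRelations A k T X).mkQ z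
      = (balancingRelations A k T X).mkQ (∑ i, t i ⊗ₜ[k] f i) := by
  induction z with
  | zero => exact ⟨0, by simp⟩
  | tmul t h =>
    obtain ⟨y, rfl⟩ := hf h
    refine ⟨fun i => y i t, ?_⟩
    rw [TensorProduct.tmul_sum, map_sum, map_sum]
    exact Finset.sum_congr rfl fun i _ => mk_tmul_comp _ _ _
  | add z₁ z₂ h₁ h₂ =>
    obtain ⟨t₁, h₁⟩ := h₁
    obtain ⟨t₂, h₂⟩ := h₂
    refine ⟨t₁ + t₂, ?_⟩
    rw [map_add, h₁, h₂, ← map_add, ← Finset.sum_add_distrib]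
    simp only [Pi.add_apply, TensorProduct.add_tmul]

variable [Algebra k A] [IsScalarTower k A T] [SMulCommClass A k T] [IsScalarTower k A X]

theorem lift_evB_tmul (t : T) (f : T →ₗ[A] X) :
    TensorProduct.lift (evB k A T X) (t ⊗ₜ[k] f) = f t := rfl

theorem balancingRelations_le_ker :
    balancingRelations A k T X ≤ LinearMap.ker (TensorProduct.lift (evB k A T X)) := by
  refine Submodule.span_le.2 ?_
  rintro _ ⟨t, φ, f, rfl⟩
  rw [SetLike.mem_coe, LinearMap.mem_ker, map_sub, lift_evB_tmul, lift_evB_tmul]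
  exact sub_self _

variable {P : Type u} [AddCommGroup P] [Module A P] {π : P →ₗ[A] T}
  {m : ℕ} {j : A →ₗ[A] (Fin m → T)}

theorem ExtendsFromKer.lift_evB_surjective [Module.Projective A P]
    (hπ : Function.Surjective π) (hX : ExtendsFromKer π X) (hj : Function.Injective j)
    (hadd : InAdd A T ((Fin m → T) ⧸ LinearMap.range j)) :
    Function.Surjective (TensorProduct.lift (evB k A T X)) := by
  intro x
  obtain ⟨g, rfl⟩ := hX.exists_eq_sum hπ j hj hadd x
  exact ⟨∑ l, j 1 l ⊗ₜ[k] g l, by rw [map_sum]; rfl⟩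

theorem ExtendsFromKer.ker_lift_evB [Module.Projective A P]
    (hπ : Function.Surjective π) (hT : ExtendsFromKer π T) (hj : Function.Injective j)
    (hadd : InAdd A T ((Fin m → T) ⧸ LinearMap.range j)) {n : ℕ} (f : Fin n → (T →ₗ[A] X))
    (hf : ∀ h : T →ₗ[A] X, ∃ y : Fin n → Module.End A T, h = ∑ i, f i ∘ₗ y i) :
    LinearMap.ker (TensorProduct.lift (evB k A T X)) = balancingRelations A k T X := by
  refine le_antisymm (fun z hz => ?_) balancingRelations_le_ker
  obtain ⟨t, ht⟩ := exists_mk_eq_sum f hf z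
  have ht0 : ∑ i, f i (t i) = 0 := by
    have h1 := balancingRelations_le_ker ((Submodule.Quotient.eq _).1 ht)
    rw [LinearMap.mem_ker, map_sub, LinearMap.mem_ker.1 hz, map_sum, zero_sub,
      neg_eq_zero] at h1
    exact h1
  obtain ⟨κ, hκ, hκf⟩ := hT.exists_relations hπ hj hadd f hf t ht0
  refine (Submodule.Quotient.mk_eq_zero _).1 (ht.trans ?_)
  have h1 : ∀ l, ∑ i, (balancingRelations A k T X).mkQ (κ l i (j 1 l) ⊗ₜ[k] f i) = 0 := by
    intro l
    simp only [← mk_tmul_comp]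
    rw [← map_sum, ← TensorProduct.tmul_sum, hκf, TensorProduct.tmul_zero, map_zero]
  simp only [hκ, TensorProduct.sum_tmul, map_sum]
  rw [Finset.sum_comm]
  exact Finset.sum_eq_zero fun l _ => h1 l

end Evaluation

end Tilting

/-- **Brenner–Butler tilting theorem.** Let `A` be a finite-dimensional
algebra, `T` a tilting `A`-module of projective dimension at most `1`, and
`B = End_A(T)ᵒᵖ`.  Then `Hom_A(T, −)` restricts to an equivalence between the subcategory
`𝒯 = { X | Ext¹_A(T, X) = 0 }` of `mod A` and the subcategory
`𝒴 = { Y | Tor₁^B(T, Y) = 0 }` of `mod B`, with quasi-inverse `T ⊗_B −`: it is fully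
faithful on `𝒯`, lands in `𝒴`, every finitely generated `Y ∈ 𝒴` is isomorphic (as a
`B`-module) to `Hom_A(T, X)` for some `X ∈ 𝒯`, and for `X ∈ 𝒯` the evaluation map induces
an isomorphism `T ⊗_B Hom_A(T, X) ≅ X` (surjectivity together with kernel equal to the span
of the `B`-balancing relations). -/
theorem brenner_butler_tilting
    (k : Type u) [Field k] (A : Type u) [Ring A] [Algebra k A] [FiniteDimensional k A]
    (T : Type u) [AddCommGroup T] [Module k T] [Module A T] [IsScalarTower k A T]
    [SMulCommClass A k T] [FiniteDimensional k T]
    -- `T` has projective dimension at most 1: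
    (hpd : ∃ (n : ℕ) (p : (Fin n → A) →ₗ[A] T),
      Function.Surjective p ∧ Module.Projective A (LinearMap.ker p))
    -- `Ext¹_A(T, T) = 0`:
    (hself : Ext1Vanish A T T)
    -- there is an exact sequence `0 → A → T⁰ → T¹ → 0` with `T⁰, T¹ ∈ add T`:
    (hcores : ∃ (m : ℕ) (j : A →ₗ[A] (Fin m → T)), Function.Injective j ∧
      InAdd A T ((Fin m → T) ⧸ LinearMap.range j)) :
    -- (1) `Hom_A(T, −)` sends `𝒯` into `𝒴`:
    (∀ (X : Type u) [AddCommGroup X] [Module k X] [Module A X] [IsScalarTower k A X]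
        [SMulCommClass A k X] [FiniteDimensional k X],
      Ext1Vanish A T X →
        Tor1Vanish A T (T →ₗ[A] X) (fun φ f => f ∘ₗ φ))
    -- (2) `Hom_A(T, −)` is fully faithful on `𝒯`:
    ∧ (∀ (X X' : Type u) [AddCommGroup X] [Module k X] [Module A X] [IsScalarTower k A X]
        [SMulCommClass A k X] [FiniteDimensional k X]
        [AddCommGroup X'] [Module k X'] [Module A X'] [IsScalarTower k A X']
        [SMulCommClass A k X'] [FiniteDimensional k X'],
      Ext1Vanish A T X → Ext1Vanish A T X' →
        (∀ ψ ψ' : X →ₗ[A] X', (∀ f : T →ₗ[A] X, ψ ∘ₗ f = ψ' ∘ₗ f) → ψ = ψ') ∧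
        (∀ g : (T →ₗ[A] X) → (T →ₗ[A] X'),
          (∀ f₁ f₂, g (f₁ + f₂) = g f₁ + g f₂) →
          (∀ (φ : Module.End A T) f, g (f ∘ₗ φ) = (g f) ∘ₗ φ) →
          ∃ ψ : X →ₗ[A] X', ∀ f, g f = ψ ∘ₗ f))
    -- (3) every finitely generated `Y ∈ 𝒴` is of the form `Hom_A(T, X)` with `X ∈ 𝒯`:
    ∧ (∀ (Y : Type u) [AddCommGroup Y] (act : Module.End A T → Y → Y),
        (∀ φ y₁ y₂, act φ (y₁ + y₂) = act φ y₁ + act φ y₂) →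
        (∀ φ₁ φ₂ y, act φ₁ y + act φ₂ y = act (φ₁ + φ₂) y) →
        (∀ y, act 1 y = y) →
        (∀ φ ψ y, act (φ * ψ) y = act ψ (act φ y)) →
        (∃ (n : ℕ) (w : Fin n → Y), ∀ y, ∃ φv : Fin n → Module.End A T,
          y = ∑ i, act (φv i) (w i)) →
        Tor1Vanish A T Y act →
        ∃ X : ModuleCat.{u} A, Ext1Vanish A T X ∧
          ∃ ee : (T →ₗ[A] X) ≃+ Y,
            ∀ (φ : Module.End A T) (f : T →ₗ[A] X), ee (f ∘ₗ φ) = act φ (ee f))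
    -- (4) the quasi-inverse is `T ⊗_B −`: for `X ∈ 𝒯` the evaluation map induces an
    -- isomorphism `T ⊗_B Hom_A(T, X) ≅ X`:
    ∧ (∀ (X : Type u) [AddCommGroup X] [Module k X] [Module A X] [IsScalarTower k A X]
        [SMulCommClass A k X] [FiniteDimensional k X],
      Ext1Vanish A T X →
        Function.Surjective (TensorProduct.lift (evB k A T X)) ∧
        LinearMap.ker (TensorProduct.lift (evB k A T X))
          = Submodule.span k
              {z : T ⊗[k] (T →ₗ[A] X) | ∃ (tt : T) (φ : Module.End A T) (f : T →ₗ[A] X),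
                z = (φ tt) ⊗ₜ[k] f - tt ⊗ₜ[k] (f ∘ₗ φ)}) := by
  obtain ⟨n, π, hπ, hproj⟩ := hpd
  obtain ⟨m, j, hj, hadd⟩ := hcores
  have hT : ExtendsFromKer π T := hself.exists_extension π hπ
  refine ⟨?_, ?_, ?_, ?_⟩
  · intro X _ _ _ _ _ _ _
    exact tor1Vanish_linearMap hπ hT hj hadd
  · intro X X' _ _ _ _ _ _ _ _ _ _ _ _ hX _
    have hX : ExtendsFromKer π X := hX.exists_extension π hπ
    refine ⟨fun ψ ψ' h => LinearMap.ext fun x => ?_, fun g hg hgcomp => ?_⟩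
    · obtain ⟨g, rfl⟩ := hX.exists_eq_sum hπ j hj hadd x
      rw [map_sum, map_sum]
      exact Finset.sum_congr rfl fun l _ => LinearMap.congr_fun (h (g l)) _
    · obtain ⟨r, f, hf⟩ := exists_generators_linearMap (k := k) (A := A) (T := T) (X := X)
      exact hT.exists_eq_comp hπ hX hj hadd f hf g hg hgcomp
  · intro Y _ act hact hact' hone hmul ⟨r, w, hw⟩ hTor
    let q : (Fin r → Module.End A T) →+ Y :=
      AddMonoidHom.mk' (fun x => ∑ i, act (x i) (w i)) fun x y => by
        simp only [← Finset.sum_add_distrib, hact', Pi.add_apply]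
    have hqmul : ∀ (φ : Module.End A T) (x), q (fun i => x i * φ) = act φ (q x) := by
      intro φ x
      have h1 : q (fun i => x i * φ) = ∑ i, act φ (act (x i) (w i)) := by
        change ∑ i, act (x i * φ) (w i) = _
        simp only [hmul]
      exact h1.trans (map_sum (AddMonoidHom.mk' (act φ) (hact φ)) (fun i => act (x i) (w i)) _).symm
    have hqsurj : Function.Surjective q := fun y => by
      obtain ⟨x, rfl⟩ := hw y
      exact ⟨x, rfl⟩
    obtain ⟨n1, d1, hd1⟩ := exists_matrix_of_right_submodule k q.ker fun x hx φ => by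
      rw [AddMonoidHom.mem_ker] at hx ⊢
      rw [hqmul, hx]
      exact map_zero (AddMonoidHom.mk' (act φ) (hact φ))
    let D : (Fin n1 → Module.End A T) →+ (Fin r → Module.End A T) :=
      AddMonoidHom.mk' (fun x l => ∑ i, d1 l i * x i) fun x y => by
        funext l
        simp only [Pi.add_apply, mul_add, Finset.sum_add_distrib]
    obtain ⟨n2, d2, hd2⟩ := exists_matrix_of_right_submodule k D.ker fun x hx φ => by
      rw [AddMonoidHom.mem_ker] at hx ⊢
      funext l
      have h1 : (∑ i, d1 l i * x i) * φ = 0 := by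
        rw [show ∑ i, d1 l i * x i = 0 from congrFun hx l, zero_mul]
      rw [Finset.sum_mul] at h1
      simp only [mul_assoc] at h1
      exact h1
    have hexact := hTor r n1 n2 q d1 d2 q.map_add hqmul hqsurj hd1 hd2
    refine exists_linearMap_addEquiv hπ hT act q d1 d2 hqmul hqsurj hd1 fun u => ⟨fun hu => ?_, ?_⟩
    · obtain ⟨v, hv⟩ := hexact u fun l => by rw [← matrixMap_apply, hu, Pi.zero_apply]
      exact ⟨v, funext fun l => by rw [matrixMap_apply, hv]⟩
    · rintro ⟨v, rfl⟩
      rw [← Finset.univ_sum_single v, map_sum, map_sum]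
      refine Finset.sum_eq_zero fun i _ => ?_
      have h1 := (hd2 fun l => d2 l i).2 ⟨Pi.single i 1, by
        funext l
        simp [Pi.single_apply]⟩
      have h2 : (fun l => ∑ i', d1 l i' * d2 i' i) = 0 := h1
      rw [matrixMap_single, matrixMap_pi, h2]
      rfl
  · intro X _ _ _ _ _ _ hX
    have hX : ExtendsFromKer π X := hX.exists_extension π hπ
    obtain ⟨r, f, hf⟩ := exists_generators_linearMap (k := k) (A := A) (T := T) (X := X)
    exact ⟨hX.lift_evB_surjective hπ hj hadd, hT.ker_lift_evB hπ hj hadd f hf⟩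
end
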